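/- Let Ṽ_3 be the subgroup of SG_3 generated by a13, a23, b13, b23, b12 and let C be the subgroup generated by a12. Then SP_3 = ker π is the internal semidirect product of Ṽ_3 by C ≅ ℤ: Ṽ_3 is a normal subgroup of SP_3, the element a12 has infinite order (so C ≅ ℤ), Ṽ_3 ∩ C = {1}, and Ṽ_3 and C together generate SP_3. -/

import Mathlib

/-- Defining relations of the singular braid group `SG₃`, as elements of the free
group on four generators `0 ↦ σ₁`, `1 ↦ σ₂`, `2 ↦ τ₁`, `3 ↦ τ₂`. -/
def sg3Rels : Set (FreeGroup (Fin 4)) :=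
  {FreeGroup.of 0 * FreeGroup.of 2 * (FreeGroup.of 2 * FreeGroup.of 0)⁻¹,
   FreeGroup.of 1 * FreeGroup.of 3 * (FreeGroup.of 3 * FreeGroup.of 1)⁻¹,
   FreeGroup.of 0 * FreeGroup.of 1 * FreeGroup.of 0 *
     (FreeGroup.of 1 * FreeGroup.of 0 * FreeGroup.of 1)⁻¹,
   FreeGroup.of 0 * FreeGroup.of 1 * FreeGroup.of 2 *
     (FreeGroup.of 3 * FreeGroup.of 0 * FreeGroup.of 1)⁻¹,
   FreeGroup.of 1 * FreeGroup.of 0 * FreeGroup.of 3 *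
     (FreeGroup.of 2 * FreeGroup.of 1 * FreeGroup.of 0)⁻¹}

/-- The singular braid group on 3 strands. -/
abbrev SG3 : Type := PresentedGroup sg3Rels

def σ1 : SG3 := PresentedGroup.of 0
def σ2 : SG3 := PresentedGroup.of 1
def τ1 : SG3 := PresentedGroup.of 2
def τ2 : SG3 := PresentedGroup.of 3

def a12 : SG3 := σ1 ^ 2
def a13 : SG3 := σ2 * σ1 ^ 2 * σ2⁻¹
def a23 : SG3 := σ2 ^ 2
def b12 : SG3 := σ1 * τ1
def b13 : SG3 := σ2 * σ1 * τ1 * σ2⁻¹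
def b23 : SG3 := σ2 * τ2

lemma rel_of {x y : FreeGroup (Fin 4)} (h : x * y⁻¹ ∈ sg3Rels) :
    PresentedGroup.mk sg3Rels x = PresentedGroup.mk sg3Rels y := by
  have h1 := PresentedGroup.one_of_mem h
  rw [map_mul, map_inv] at h1
  exact mul_inv_eq_one.mp h1

lemma r1 : σ1 * τ1 = τ1 * σ1 :=
  rel_of (x := FreeGroup.of 0 * FreeGroup.of 2) (y := FreeGroup.of 2 * FreeGroup.of 0)
    (by simp only [sg3Rels, Set.mem_insert_iff, true_or])
lemma r2 : σ2 * τ2 = τ2 * σ2 :=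
  rel_of (x := FreeGroup.of 1 * FreeGroup.of 3) (y := FreeGroup.of 3 * FreeGroup.of 1)
    (by simp only [sg3Rels, Set.mem_insert_iff, true_or, or_true])
lemma r3 : σ1 * σ2 * σ1 = σ2 * σ1 * σ2 :=
  rel_of (x := FreeGroup.of 0 * FreeGroup.of 1 * FreeGroup.of 0)
    (y := FreeGroup.of 1 * FreeGroup.of 0 * FreeGroup.of 1)
    (by simp only [sg3Rels, Set.mem_insert_iff, true_or, or_true])
lemma r4 : σ1 * σ2 * τ1 = τ2 * σ1 * σ2 :=
  rel_of (x := FreeGroup.of 0 * FreeGroup.of 1 * FreeGroup.of 2)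
    (y := FreeGroup.of 3 * FreeGroup.of 0 * FreeGroup.of 1)
    (by simp only [sg3Rels, Set.mem_insert_iff, true_or, or_true])
lemma r5 : σ2 * σ1 * τ2 = τ1 * σ2 * σ1 :=
  rel_of (x := FreeGroup.of 1 * FreeGroup.of 0 * FreeGroup.of 3)
    (y := FreeGroup.of 2 * FreeGroup.of 1 * FreeGroup.of 0)
    (by simp only [sg3Rels, Set.mem_insert_iff, Set.mem_singleton_iff, or_true])

/-- Every subgroup containing the four generators is everything. -/
lemma mem_of_gens (K : Subgroup SG3) (h1 : σ1 ∈ K) (h2 : σ2 ∈ K) (h3 : τ1 ∈ K) (h4 : τ2 ∈ K)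
    (g : SG3) : g ∈ K := by
  have h : (⊤ : Subgroup SG3) ≤ K := by
    rw [← PresentedGroup.closure_range_of sg3Rels, Subgroup.closure_le]
    rintro _ ⟨i, rfl⟩
    fin_cases i
    exacts [h1, h2, h3, h4]
  exact h trivial

/-- The half twist. -/
def halfT : SG3 := σ1 * σ2 * σ1

lemma d1 : halfT * σ1 = σ2 * halfT := by
  unfold halfT; nth_rewrite 1 [r3]; simp only [mul_assoc]
lemma d2 : halfT * σ2 = σ1 * halfT := by
  unfold halfT; nth_rewrite 2 [r3]; simp only [mul_assoc]
lemma d3 : halfT * τ1 = τ2 * halfT := by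
  unfold halfT; rw [mul_assoc, r1, ← mul_assoc, r4]; simp only [mul_assoc]
lemma d4 : halfT * τ2 = τ1 * halfT := by
  unfold halfT; rw [r3, mul_assoc, r2, ← mul_assoc, r5]; simp only [mul_assoc]

lemma sq_comm {s t : SG3} (h : halfT * s = t * halfT) (h' : halfT * t = s * halfT) :
    halfT ^ 2 * s = s * halfT ^ 2 := by
  rw [pow_two, mul_assoc, h, ← mul_assoc, h', mul_assoc]

lemma full_central (g : SG3) : halfT ^ 2 * g = g * halfT ^ 2 := by
  have := mem_of_gens (Subgroup.centralizer {halfT ^ 2})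
    (by simpa [Subgroup.mem_centralizer_iff] using sq_comm d1 d2)
    (by simpa [Subgroup.mem_centralizer_iff] using sq_comm d2 d1)
    (by simpa [Subgroup.mem_centralizer_iff] using sq_comm d3 d4)
    (by simpa [Subgroup.mem_centralizer_iff] using sq_comm d4 d3) g
  simpa [Subgroup.mem_centralizer_iff] using this

lemma w_eq : a13 * a23 * a12 = halfT ^ 2 := by
  have h : halfT ^ 2 = σ1 * (a13 * a23) * σ1 := by
    unfold halfT a13 a23; simp only [pow_two, mul_assoc, inv_mul_cancel_left]
  have h2 := full_central σ1
  rw [h] at h2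
  have h3 : σ1 * (a13 * a23 * σ1 * σ1) = σ1 * (σ1 * (a13 * a23) * σ1) := by
    rw [← h2]; simp only [mul_assoc]
  have h4 := mul_left_cancel h3
  rw [h, ← h4, a12]; simp only [mul_assoc, pow_two]

/-- The group `V`. -/
abbrev Vt : Subgroup SG3 := Subgroup.closure {a13, a23, b13, b23, b12}

lemma m13 : a13 ∈ Vt := Subgroup.subset_closure (by simp)
lemma m23 : a23 ∈ Vt := Subgroup.subset_closure (by simp)
lemma n13 : b13 ∈ Vt := Subgroup.subset_closure (by simp)
lemma n23 : b23 ∈ Vt := Subgroup.subset_closure (by simp)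
lemma n12 : b12 ∈ Vt := Subgroup.subset_closure (by simp)

lemma a12_eq : a12 = (a13 * a23)⁻¹ * halfT ^ 2 := by
  rw [← w_eq]; group

lemma conj_a12 (v : SG3) : a12 * v * a12⁻¹ = (a13 * a23)⁻¹ * v * (a13 * a23) := by
  rw [a12_eq, mul_assoc _ (halfT ^ 2) v, full_central]; group

lemma a12_norm : a12 ∈ Subgroup.normalizer (Vt : Set SG3) := by
  have hw : a13 * a23 ∈ Vt := mul_mem m13 m23
  rw [Subgroup.mem_normalizer_iff]
  intro v
  rw [conj_a12]
  constructor
  · intro hv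
    exact mul_mem (mul_mem (inv_mem hw) hv) hw
  · intro hv
    have := mul_mem (mul_mem hw hv) (inv_mem hw)
    convert this using 1
    group

/-- The group generated by all `a` and `b`. -/
abbrev Ht : Subgroup SG3 := Vt ⊔ Subgroup.zpowers a12

lemma V_le : Vt ≤ Ht := le_sup_left
lemma m12 : a12 ∈ Ht := (le_sup_right : _ ≤ Ht) (Subgroup.mem_zpowers a12)

lemma H_norm : Ht ≤ Subgroup.normalizer (Vt : Set SG3) :=
  sup_le Subgroup.le_normalizer (by rw [Subgroup.zpowers_le]; exact a12_norm)

lemma Ht_conj (s : SG3) (h1 : s * a12 * s⁻¹ ∈ Ht) (h2 : s * a13 * s⁻¹ ∈ Ht)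
    (h3 : s * a23 * s⁻¹ ∈ Ht) (h4 : s * b12 * s⁻¹ ∈ Ht) (h5 : s * b13 * s⁻¹ ∈ Ht)
    (h6 : s * b23 * s⁻¹ ∈ Ht) (v : SG3) (hv : v ∈ Ht) : s * v * s⁻¹ ∈ Ht := by
  have : Ht ≤ Ht.comap (MulAut.conj s).toMonoidHom := by
    refine sup_le ?_ ?_
    · rw [Subgroup.closure_le]
      rintro x (rfl | rfl | rfl | rfl | rfl)
      exacts [h2, h3, h5, h6, h4]
    · rw [Subgroup.zpowers_le]; exact h1
  exact this hv

/-- Being in the normalizer from conjugation statements in both directions. -/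
lemma norm_of (s : SG3) (h : ∀ v ∈ Ht, s * v * s⁻¹ ∈ Ht) (h' : ∀ v ∈ Ht, s⁻¹ * v * s⁻¹⁻¹ ∈ Ht) :
    s ∈ Subgroup.normalizer (Ht : Set SG3) := by
  rw [Subgroup.mem_normalizer_iff]
  intro v
  refine ⟨h v, fun hv => ?_⟩
  have := h' _ hv
  convert this using 1
  group

lemma norm_of_sq (s : SG3) (hs : s ^ 2 ∈ Ht) (h : ∀ v ∈ Ht, s * v * s⁻¹ ∈ Ht) :
    s ∈ Subgroup.normalizer (Ht : Set SG3) := by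
  refine norm_of s h fun v hv => ?_
  have := mul_mem (mul_mem (inv_mem hs) (h v hv)) hs
  convert this using 1
  group

lemma c_a13 : σ1 * a13 * σ1⁻¹ = a23 := by
  have h : σ1 * σ2 * σ1 ^ 2 = σ2 ^ 2 * σ1 * σ2 := by
    calc σ1 * σ2 * σ1 ^ 2 = (σ1 * σ2 * σ1) * σ1 := by simp only [mul_assoc, pow_two]
      _ = σ2 * (σ1 * σ2 * σ1) := by rw [r3]; simp only [mul_assoc]; rw [← mul_assoc σ1, r3]; simp only [mul_assoc]
      _ = _ := by rw [r3]; simp only [mul_assoc, pow_two]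
  calc σ1 * a13 * σ1⁻¹ = (σ1 * σ2 * σ1 ^ 2) * σ2⁻¹ * σ1⁻¹ := by unfold a13; group
    _ = _ := by rw [h, a23]; group

lemma c_b13 : σ1 * b13 * σ1⁻¹ = b23 := by
  have h : σ1 * σ2 * (σ1 * τ1) = σ2 * τ2 * (σ1 * σ2) := by
    calc σ1 * σ2 * (σ1 * τ1) = (σ1 * σ2 * σ1) * τ1 := by simp only [mul_assoc]
      _ = σ2 * (σ1 * σ2 * τ1) := by rw [r3]; simp only [mul_assoc]
      _ = _ := by rw [r4]; simp only [mul_assoc]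
  calc σ1 * b13 * σ1⁻¹ = (σ1 * σ2 * (σ1 * τ1)) * σ2⁻¹ * σ1⁻¹ := by unfold b13; group
    _ = _ := by rw [h, b23]; group

lemma s1_norm : σ1 ∈ Subgroup.normalizer (Ht : Set SG3) := by
  have hc := m12
  refine norm_of_sq σ1 m12 (Ht_conj σ1 ?_ ?_ ?_ ?_ ?_ ?_)
  · convert m12 using 1
    unfold a12; group
  · rw [c_a13]; exact V_le m23
  · have := mul_mem (mul_mem hc (V_le m13)) (inv_mem hc)
    convert this using 1
    rw [← c_a13, a12]; group; rw [zpow_two]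
  · convert V_le n12 using 1
    unfold b12; nth_rewrite 1 [r1]; group
  · rw [c_b13]; exact V_le n23
  · have := mul_mem (mul_mem hc (V_le n13)) (inv_mem hc)
    convert this using 1
    rw [← c_b13, a12]; group; rw [zpow_two]

lemma s2_norm : σ2 ∈ Subgroup.normalizer (Ht : Set SG3) := by
  have hc := V_le m23
  refine norm_of_sq σ2 hc (Ht_conj σ2 ?_ ?_ ?_ ?_ ?_ ?_)
  · exact V_le m13
  · have := mul_mem (mul_mem hc m12) (inv_mem hc)
    convert this using 1
    unfold a13 a12 a23; group; rw [zpow_two σ2]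
  · convert hc using 1
    unfold a23; group
  · convert V_le n13 using 1
    unfold b12 b13; group
  · have := mul_mem (mul_mem hc (V_le n12)) (inv_mem hc)
    convert this using 1
    unfold b13 b12 a23; group; rw [zpow_two]
  · convert V_le n23 using 1
    unfold b23; nth_rewrite 1 [r2]; group

lemma t1_eq : τ1 = σ1⁻¹ * b12 := by unfold b12; group
lemma t2_eq : τ2 = σ2⁻¹ * b23 := by unfold b23; group

instance H_normal : Ht.Normal := by
  rw [← Subgroup.normalizer_eq_top_iff, eq_top_iff]
  intro g _
  refine mem_of_gens _ s1_norm s2_norm ?_ ?_ g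
  · rw [t1_eq]
    exact mul_mem (inv_mem s1_norm) (Subgroup.le_normalizer (V_le n12))
  · rw [t2_eq]
    exact mul_mem (inv_mem s2_norm) (Subgroup.le_normalizer (V_le n23))

/-- The quotient map. -/
abbrev qm : SG3 →* SG3 ⧸ Ht := QuotientGroup.mk' Ht

lemma qm_one {g : SG3} (h : g ∈ Ht) : qm g = 1 := (QuotientGroup.eq_one_iff g).mpr h

lemma reps (g : SG3) : ∃ r ∈ ({1, σ1, σ2, σ1 * σ2, σ2 * σ1, σ1 * σ2 * σ1} : Set SG3),
    qm g = qm r := by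
  have hx : qm σ1 * qm σ1 = 1 := by
    rw [← map_mul, ← pow_two]; exact qm_one m12
  have hy : qm σ2 * qm σ2 = 1 := by
    rw [← map_mul, ← pow_two]; exact qm_one (V_le m23)
  have hbr : qm σ1 * (qm σ2 * qm σ1) = qm σ2 * (qm σ1 * qm σ2) := by
    simp only [← map_mul, ← mul_assoc, r3]
  have hx' : (qm σ1)⁻¹ = qm σ1 := inv_eq_of_mul_eq_one_left hx
  have hy' : (qm σ2)⁻¹ = qm σ2 := inv_eq_of_mul_eq_one_left hy
  have ht1 : qm τ1 = qm σ1 := by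
    rw [t1_eq, map_mul, map_inv, qm_one (V_le n12), hx', mul_one]
  have ht2 : qm τ2 = qm σ2 := by
    rw [t2_eq, map_mul, map_inv, qm_one (V_le n23), hy', mul_one]
  let S : Set (SG3 ⧸ Ht) := {1, qm σ1, qm σ2, qm σ1 * qm σ2, qm σ2 * qm σ1,
    qm σ1 * (qm σ2 * qm σ1)}
  have hxx : ∀ u, qm σ1 * (qm σ1 * u) = u := fun u => by rw [← mul_assoc, hx, one_mul]
  have hyy : ∀ u, qm σ2 * (qm σ2 * u) = u := fun u => by rw [← mul_assoc, hy, one_mul]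
  have hS1 : ∀ u ∈ S, qm σ1 * u ∈ S := by
    rintro u (rfl | rfl | rfl | rfl | rfl | rfl)
    · rw [mul_one]; simp [S]
    · rw [hx]; simp [S]
    · simp [S]
    · rw [hxx]; simp [S]
    · simp [S]
    · rw [hxx]; simp [S]
  have hS2 : ∀ u ∈ S, qm σ2 * u ∈ S := by
    rintro u (rfl | rfl | rfl | rfl | rfl | rfl)
    · rw [mul_one]; simp [S]
    · simp [S]
    · rw [hy]; simp [S]
    · rw [← hbr]; simp [S]
    · rw [hyy]; simp [S]
    · rw [hbr, hyy]; simp [S]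
  have key : ∀ g : SG3, qm g ∈ S := by
    intro g
    have hg : g ∈ Subgroup.closure (Set.range (PresentedGroup.of (rels := sg3Rels))) := by
      rw [PresentedGroup.closure_range_of]; trivial
    have hgen : ∀ i : Fin 4, qm (PresentedGroup.of i) = qm σ1 ∨ qm (PresentedGroup.of i) = qm σ2 := by
      intro i
      fin_cases i
      exacts [Or.inl rfl, Or.inr rfl, Or.inl ht1, Or.inr ht2]
    induction hg using Subgroup.closure_induction_left with
    | one => rw [map_one]; simp [S]
    | mul_left x hx0 y _ ih =>
      obtain ⟨i, rfl⟩ := hx0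
      rw [map_mul]
      rcases hgen i with h | h <;> rw [h]
      exacts [hS1 _ ih, hS2 _ ih]
    | inv_mul_cancel x hx0 y _ ih =>
      obtain ⟨i, rfl⟩ := hx0
      rw [map_mul, map_inv]
      rcases hgen i with h | h <;> rw [h]
      · rw [hx']; exact hS1 _ ih
      · rw [hy']; exact hS2 _ ih
  rcases key g with h | h | h | h | h | h
  · exact ⟨1, by simp, by rw [h, map_one]⟩
  · exact ⟨σ1, by simp, h⟩
  · exact ⟨σ2, by simp, h⟩
  · exact ⟨σ1 * σ2, by simp, by rw [h, map_mul]⟩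
  · exact ⟨σ2 * σ1, by simp, by rw [h, map_mul]⟩
  · exact ⟨σ1 * σ2 * σ1, by simp, by rw [h, map_mul, map_mul, mul_assoc]⟩

/-- Permutation of (opposite vertices of) edges with a shift on one edge. -/
def shiftPerm (p : Equiv.Perm (Fin 3)) (e : Fin 3) (k : ℤ) : Equiv.Perm (Fin 3 × ℤ) where
  toFun x := (p x.1, x.2 + if x.1 = e then k else 0)
  invFun x := (p.symm x.1, x.2 - if p.symm x.1 = e then k else 0)
  left_inv x := by simp
  right_inv x := by simp

/-- Images of the generators. -/
def genImg : Fin 4 → Equiv.Perm (Fin 3 × ℤ) :=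
  ![shiftPerm (Equiv.swap 0 1) 2 1, shiftPerm (Equiv.swap 1 2) 0 1,
    shiftPerm (Equiv.swap 0 1) 2 (-1), shiftPerm (Equiv.swap 1 2) 0 (-1)]

lemma genImg_rels : ∀ r ∈ sg3Rels, FreeGroup.lift genImg r = 1 := by
  rintro r (rfl | rfl | rfl | rfl | rfl) <;>
  · simp only [map_mul, map_inv, FreeGroup.lift_apply_of]
    rw [mul_inv_eq_one]
    ext ⟨e, n⟩ <;> fin_cases e <;>
      simp [genImg, shiftPerm, Equiv.swap_apply_def]

/-- The linking representation. -/
def link : SG3 →* Equiv.Perm (Fin 3 × ℤ) := PresentedGroup.toGroup genImg_rels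

lemma link_σ1 : link σ1 = shiftPerm (Equiv.swap 0 1) 2 1 := PresentedGroup.toGroup.of genImg_rels
lemma link_σ2 : link σ2 = shiftPerm (Equiv.swap 1 2) 0 1 := PresentedGroup.toGroup.of genImg_rels
lemma link_τ1 : link τ1 = shiftPerm (Equiv.swap 0 1) 2 (-1) :=
  PresentedGroup.toGroup.of genImg_rels
lemma link_τ2 : link τ2 = shiftPerm (Equiv.swap 1 2) 0 (-1) :=
  PresentedGroup.toGroup.of genImg_rels

lemma link_a12 (n : ℤ) : link a12 (2, n) = (2, n + 2) := by
  simp [a12, pow_two, link_σ1, shiftPerm, Equiv.swap_apply_def]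
  ring

lemma σ2_inv (n : ℤ) : (shiftPerm (Equiv.swap 1 2) 0 1)⁻¹ (2, n) = (1, n) := by
  rw [Equiv.Perm.inv_eq_iff_eq]
  simp [shiftPerm]

lemma link_V (v : SG3) (hv : v ∈ Vt) : link v (2, 0) = (2, 0) := by
  have : Vt ≤ (MulAction.stabilizer (Equiv.Perm (Fin 3 × ℤ)) ((2, 0) : Fin 3 × ℤ)).comap link := by
    rw [Subgroup.closure_le]
    rintro x (rfl | rfl | rfl | rfl | rfl) <;>
      rw [SetLike.mem_coe, Subgroup.mem_comap, MulAction.mem_stabilizer_iff, Equiv.Perm.smul_def] <;>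
      simp only [a13, a23, b13, b23, b12, map_mul, map_inv, pow_two, link_σ1, link_σ2, link_τ1,
        link_τ2, Equiv.Perm.mul_apply, σ2_inv] <;>
      simp [shiftPerm, Equiv.swap_apply_def]
  exact this hv

lemma link_zpow (k : ℤ) : ∀ n : ℤ, link (a12 ^ k) (2, n) = (2, n + 2 * k) := by
  induction k using Int.induction_on with
  | zero => intro n; simp
  | succ i ih =>
    intro n
    rw [zpow_add_one, map_mul, Equiv.Perm.mul_apply, link_a12, ih]
    congr 1; ring
  | pred i ih =>
    intro n
    have h : link a12 (2, n - 2) = (2, n) := by rw [link_a12]; congr 1; ring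
    rw [zpow_sub_one, map_mul, Equiv.Perm.mul_apply, map_inv,
      Equiv.Perm.inv_eq_iff_eq.mpr h.symm, ih]
    congr 1; ring

/-- `SP₃` is the internal semidirect product of `Ṽ₃ = ⟨a₁₃, a₂₃, b₁₃, b₂₃, b₁₂⟩`
by the infinite cyclic subgroup `C = ⟨a₁₂⟩`. -/
theorem stmt10 (π : SG3 →* Equiv.Perm (Fin 3))
    (hσ1 : π σ1 = Equiv.swap 0 1) (hτ1 : π τ1 = Equiv.swap 0 1)
    (hσ2 : π σ2 = Equiv.swap 1 2) (hτ2 : π τ2 = Equiv.swap 1 2) :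
    Subgroup.closure {a13, a23, b13, b23, b12} ≤ MonoidHom.ker π ∧
    Subgroup.zpowers a12 ≤ MonoidHom.ker π ∧
    (∀ g ∈ MonoidHom.ker π, ∀ v ∈ Subgroup.closure {a13, a23, b13, b23, b12},
      g * v * g⁻¹ ∈ Subgroup.closure {a13, a23, b13, b23, b12}) ∧
    ¬ IsOfFinOrder a12 ∧
    Subgroup.closure {a13, a23, b13, b23, b12} ⊓ Subgroup.zpowers a12 = ⊥ ∧
    Subgroup.closure {a13, a23, b13, b23, b12} ⊔ Subgroup.zpowers a12 = MonoidHom.ker π := by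
  have hV : Vt ≤ π.ker := by
    rw [Subgroup.closure_le]
    rintro x (rfl | rfl | rfl | rfl | rfl) <;>
      simp [MonoidHom.mem_ker, a13, a23, b13, b23, b12, pow_two, hσ1, hτ1, hσ2, hτ2]
  have hC : Subgroup.zpowers a12 ≤ π.ker := by
    rw [Subgroup.zpowers_le]
    simp [MonoidHom.mem_ker, a12, pow_two, hσ1]
  have hH : Ht ≤ π.ker := sup_le hV hC
  have hHe : Ht = π.ker := by
    refine le_antisymm hH fun g hg => ?_
    obtain ⟨r, hr, h⟩ := reps g
    have hgr : g⁻¹ * r ∈ Ht := QuotientGroup.eq.mp h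
    have hr1 : π r = 1 := by
      have := hH hgr
      rwa [MonoidHom.mem_ker, map_mul, map_inv, MonoidHom.mem_ker.mp hg, inv_one, one_mul] at this
    have hr2 : r = 1 := by
      rcases hr with rfl | rfl | rfl | rfl | rfl | rfl
      · rfl
      all_goals
        exfalso
        simp only [map_mul, hσ1, hσ2] at hr1
        revert hr1
        decide
    rw [hr2, mul_one] at hgr
    exact (Subgroup.inv_mem_iff _).mp hgr
  refine ⟨hV, hC, ?_, ?_, ?_, hHe⟩
  · intro g hg v hv
    rw [← hHe] at hg
    exact (Subgroup.mem_normalizer_iff.mp (H_norm hg) v).mp hv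
  · rw [isOfFinOrder_iff_pow_eq_one]
    rintro ⟨n, hn, h⟩
    have h1 := link_zpow n 0
    rw [zpow_natCast, h, map_one, Equiv.Perm.one_apply] at h1
    have h2 := congrArg Prod.snd h1
    simp only at h2
    omega
  · rw [eq_bot_iff]
    rintro x ⟨hx, k, rfl⟩
    have h1 := link_zpow k 0
    have h3 := link_V _ hx
    simp only at h3
    rw [h1] at h3
    have h2 := congrArg Prod.snd h3
    simp only at h2
    have hk : k = 0 := by omega
    simp [hk]
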